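/- arXiv:2410.20618 — 2 statements merged into one kernel-verified Lean document; each statement's English description precedes it below -/
import Mathlib

section
/- Let A, B ⊆ ℝ be finite sets, let t ∈ (0,1] satisfy t|A| ≥ 1 and t|B| ≥ 1, and let M ⊆ A × B be a monotone set. Then the number of 6-tuples (a_1, a_2, a_1′, a_2′, b_1, b_2) ∈ A² × A² × B² such that (a_1, b_1) ∈ M, (a_2, b_2) ∈ M, the pair (a_1, a_2) is t-close in A, (a_1′, a_2′) is t-close in A, (a_1 + a_1′, a_2 + a_2′) is t-close in A + A, and (b_1, b_2) is t-close in B, is at least t²|A|²|M|²/1024. -/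
open Finset Pointwise

/-- The (1-based) index of `x` in the increasing enumeration of the finite set `X ⊆ ℝ`. -/
noncomputable def idx (X : Finset ℝ) (x : ℝ) : ℕ :=
  (X.filter (fun y => y ≤ x)).card

/-- A pair `(x₁, x₂)` is `t`-close with respect to `X` if their indices differ by at most
`t|X|`. -/
def tClose (X : Finset ℝ) (t x₁ x₂ : ℝ) : Prop :=
  |(idx X x₁ : ℝ) - (idx X x₂ : ℝ)| ≤ t * (X.card : ℝ)

/-- Cauchy–Schwarz: pigeonhole for colliding pairs. -/
lemma cs_pairs {α κ : Type*} [DecidableEq α] [DecidableEq κ] (s : Finset α) (K : Finset κ)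
    (f : α → κ) (hf : ∀ x ∈ s, f x ∈ K) :
    s.card ^ 2 ≤ K.card * ((s ×ˢ s).filter (fun z => f z.1 = f z.2)).card := by
  have h1 : s.card = ∑ k ∈ K, (s.filter (fun x => f x = k)).card :=
    Finset.card_eq_sum_card_fiberwise hf
  have h2 : ((s ×ˢ s).filter (fun z => f z.1 = f z.2)).card
      = ∑ k ∈ K, (s.filter (fun x => f x = k)).card ^ 2 := by
    rw [Finset.card_eq_sum_card_fiberwise (f := fun z : α × α => f z.1) (t := K)]
    · refine Finset.sum_congr rfl fun k _ => ?_
      rw [sq, ← Finset.card_product]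
      congr 1
      ext z
      simp only [Finset.mem_filter, Finset.mem_product]
      grind
    · intro z hz
      have hz' := Finset.mem_coe.1 hz
      simp only [Finset.mem_filter, Finset.mem_product] at hz'
      exact hf _ hz'.1.1
  rw [h2, h1]
  exact sq_sum_le_card_mul_sum_sq

/-- The class of `x`. -/
noncomputable def cls (X : Finset ℝ) (t x : ℝ) : ℤ := ⌊(idx X x : ℝ) / (t * (X.card : ℝ))⌋

lemma idx_mono (X : Finset ℝ) : Monotone (idx X) := by
  intro x y h
  unfold idx
  apply Finset.card_le_card
  intro z hz
  simp only [Finset.mem_filter] at hz ⊢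
  exact ⟨hz.1, hz.2.trans h⟩

lemma cls_mono (X : Finset ℝ) (t : ℝ) (ht : 0 < t) : Monotone (cls X t) := by
  intro x y h
  unfold cls
  apply Int.floor_le_floor
  have : (idx X x : ℝ) ≤ idx X y := by exact_mod_cast idx_mono X h
  gcongr

lemma cls_nonneg (X : Finset ℝ) (t x : ℝ) (ht : 0 < t) : 0 ≤ cls X t x := by
  unfold cls
  apply Int.floor_nonneg.2
  positivity

lemma cls_le (X : Finset ℝ) (t x : ℝ) (ht : 0 < t) (hX : 0 < X.card) : cls X t x ≤ ⌊1 / t⌋ := by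
  unfold cls
  apply Int.floor_le_floor
  have h : (idx X x : ℝ) ≤ X.card := by
    exact_mod_cast Finset.card_le_card (Finset.filter_subset _ _)
  have hX' : (0 : ℝ) < X.card := by exact_mod_cast hX
  rw [div_le_div_iff₀ (by positivity) ht]
  nlinarith

lemma close_of_cls (X : Finset ℝ) (t x y : ℝ) (ht : 0 < t) (hX : 0 < X.card)
    (h : cls X t x = cls X t y) : tClose X t x y := by
  have hX' : (0 : ℝ) < X.card := by exact_mod_cast hX
  have h1 := Int.abs_sub_lt_one_of_floor_eq_floor h
  unfold tClose
  rw [← sub_div, abs_div, abs_of_pos (show 0 < t * (X.card : ℝ) by positivity),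
    div_lt_one (by positivity)] at h1
  exact h1.le

/-- The two-dimensional key determines all the classes. -/
lemma key_inj (M : Finset (ℝ × ℝ)) (i r : ℝ → ℤ) (g : ℝ × ℝ → ℤ) (hi : Monotone i)
    (hr : Monotone r) (hg : ∀ p ∈ M, ∀ q ∈ M, p.1 < q.1 → g p ≤ g q)
    (m m' : ℝ × ℝ) (hm : m ∈ M) (hm' : m' ∈ M) (a a' : ℝ)
    (h1 : i m.1 + g m - i a = i m'.1 + g m' - i a')
    (h2 : i m.1 + g m + r (m.1 + a) = i m'.1 + g m' + r (m'.1 + a')) :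
    i m.1 = i m'.1 ∧ g m = g m' ∧ i a = i a' ∧ r (m.1 + a) = r (m'.1 + a') := by
  have key : ∀ (m m' : ℝ × ℝ) (_ : m ∈ M) (_ : m' ∈ M) (a a' : ℝ)
      (_ : i m.1 + g m - i a = i m'.1 + g m' - i a')
      (_ : i m.1 + g m + r (m.1 + a) = i m'.1 + g m' + r (m'.1 + a')),
      ¬ (i m.1 + g m < i m'.1 + g m') := by
    intro m m' hm hm' a a' h1 h2 hlt
    have ha : a < a' := hi.reflect_lt (by omega)
    have hmm : m.1 ≤ m'.1 := by
      by_contra hc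
      push Not at hc
      have := hi hc.le
      have := hg m' hm' m hm hc
      omega
    have := hr (add_le_add hmm ha.le)
    omega
  have k1 := key m m' hm hm' a a' h1 h2
  have k2 := key m' m hm' hm a' a h1.symm h2.symm
  have h3 : i m.1 = i m'.1 ∧ g m = g m' := by
    rcases lt_trichotomy m.1 m'.1 with h | h | h
    · have := hi h.le
      have := hg m hm m' hm' h
      omega
    · rw [h] at k1 k2 ⊢
      omega
    · have := hi h.le
      have := hg m' hm' m hm h
      omega
  omega

theorem stmt11 (A B : Finset ℝ) (t : ℝ) (ht0 : 0 < t) (ht1 : t ≤ 1)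
    (htA : 1 ≤ t * (A.card : ℝ)) (htB : 1 ≤ t * (B.card : ℝ))
    (M : Finset (ℝ × ℝ)) (hM : M ⊆ A ×ˢ B)
    (hmono : (∀ p ∈ M, ∀ q ∈ M, p.1 < q.1 → p.2 ≤ q.2) ∨
             (∀ p ∈ M, ∀ q ∈ M, p.1 < q.1 → q.2 ≤ p.2)) :
    t ^ 2 * (A.card : ℝ) ^ 2 * (M.card : ℝ) ^ 2 / 1024 ≤
      (({x : ℝ × ℝ × ℝ × ℝ × ℝ × ℝ |
          ∃ a₁ a₂ a₁' a₂' b₁ b₂ : ℝ, x = (a₁, a₂, a₁', a₂', b₁, b₂) ∧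
            a₁ ∈ A ∧ a₂ ∈ A ∧ a₁' ∈ A ∧ a₂' ∈ A ∧ b₁ ∈ B ∧ b₂ ∈ B ∧
            (a₁, b₁) ∈ M ∧ (a₂, b₂) ∈ M ∧
            tClose A t a₁ a₂ ∧ tClose A t a₁' a₂' ∧
            tClose (A + A) t (a₁ + a₁') (a₂ + a₂') ∧ tClose B t b₁ b₂}).ncard : ℝ) := by
  classical
  have hA : 0 < A.card := by
    rcases Nat.eq_zero_or_pos A.card with h | h
    · rw [h] at htA; norm_num at htA
    · exact h
  have hB : 0 < B.card := by
    rcases Nat.eq_zero_or_pos B.card with h | h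
    · rw [h] at htB; norm_num at htB
    · exact h
  have hAA : 0 < (A + A).card := by
    have := Finset.card_pos.1 hA
    exact Finset.card_pos.2 (this.add this)
  obtain ⟨k, hk⟩ : ∃ k : ℤ, k = ⌊1 / t⌋ := ⟨_, rfl⟩
  have hk1 : 1 ≤ k := by
    rw [hk]
    apply Int.le_floor.2
    rw [le_div_iff₀ ht0]
    simpa using ht1
  have hkt : (k : ℝ) * t ≤ 1 := by
    have : (k : ℝ) ≤ 1 / t := by rw [hk]; exact Int.floor_le _
    rwa [le_div_iff₀ ht0] at this
  obtain ⟨g, c, hgm, hgr, hgc⟩ : ∃ (g : ℝ × ℝ → ℤ) (c : ℤ),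
      (∀ p ∈ M, ∀ q ∈ M, p.1 < q.1 → g p ≤ g q) ∧ (∀ p, c ≤ g p ∧ g p ≤ c + k) ∧
      (∀ p q, g p = g q → tClose B t p.2 q.2) := by
    have hb := fun x => cls_nonneg B t x ht0
    have hb' := fun x => cls_le B t x ht0 hB
    rcases hmono with h | h
    · refine ⟨fun p => cls B t p.2, 0, ?_, ?_, ?_⟩
      · intro p hp q hq hpq
        exact cls_mono B t ht0 (h p hp q hq hpq)
      · intro p
        have := hb p.2
        have := hb' p.2
        dsimp only
        omega
      · intro p q hpq
        exact close_of_cls B t _ _ ht0 hB hpq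
    · refine ⟨fun p => - cls B t p.2, -k, ?_, ?_, ?_⟩
      · intro p hp q hq hpq
        exact neg_le_neg (cls_mono B t ht0 (h p hp q hq hpq))
      · intro p
        have := hb p.2
        have := hb' p.2
        dsimp only
        omega
      · intro p q hpq
        exact close_of_cls B t _ _ ht0 hB (neg_injective hpq)
  let F : (ℝ × ℝ) × ℝ → ℤ × ℤ := fun x =>
    (cls A t x.1.1 + g x.1 - cls A t x.2,
      cls A t x.1.1 + g x.1 + cls (A + A) t (x.1.1 + x.2))
  have hcs := cs_pairs (M ×ˢ A) (Finset.Icc (c - k) (c + 2 * k) ×ˢ Finset.Icc c (c + 3 * k)) F (by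
    intro x _
    have h1 := cls_nonneg A t x.1.1 ht0
    have h2 := cls_le A t x.1.1 ht0 hA
    have h3 := cls_nonneg A t x.2 ht0
    have h4 := cls_le A t x.2 ht0 hA
    have h5 := cls_nonneg (A + A) t (x.1.1 + x.2) ht0
    have h6 := cls_le (A + A) t (x.1.1 + x.2) ht0 hAA
    have h7 := hgr x.1
    rw [← hk] at h2 h4 h6
    simp only [F, Finset.mem_product, Finset.mem_Icc]
    omega)
  obtain ⟨P, hP⟩ : ∃ P, P = (((M ×ˢ A) ×ˢ (M ×ˢ A)).filter (fun z => F z.1 = F z.2)) := ⟨_, rfl⟩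
  rw [← hP] at hcs
  obtain ⟨S, hS⟩ : ∃ S : Set (ℝ × ℝ × ℝ × ℝ × ℝ × ℝ), S = {x : ℝ × ℝ × ℝ × ℝ × ℝ × ℝ |
          ∃ a₁ a₂ a₁' a₂' b₁ b₂ : ℝ, x = (a₁, a₂, a₁', a₂', b₁, b₂) ∧
            a₁ ∈ A ∧ a₂ ∈ A ∧ a₁' ∈ A ∧ a₂' ∈ A ∧ b₁ ∈ B ∧ b₂ ∈ B ∧
            (a₁, b₁) ∈ M ∧ (a₂, b₂) ∈ M ∧
            tClose A t a₁ a₂ ∧ tClose A t a₁' a₂' ∧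
            tClose (A + A) t (a₁ + a₁') (a₂ + a₂') ∧ tClose B t b₁ b₂} := ⟨_, rfl⟩
  rw [← hS]
  have hfin : S.Finite := by
    apply Set.Finite.subset (Finset.finite_toSet (A ×ˢ A ×ˢ A ×ˢ A ×ˢ B ×ˢ B))
    intro x hx
    rw [hS] at hx
    obtain ⟨a₁, a₂, a₁', a₂', b₁, b₂, rfl, h1, h2, h3, h4, h5, h6, -⟩ := hx
    simp only [Finset.mem_coe, Finset.mem_product]
    exact ⟨h1, h2, h3, h4, h5, h6⟩
  let G : ((ℝ × ℝ) × ℝ) × ((ℝ × ℝ) × ℝ) → ℝ × ℝ × ℝ × ℝ × ℝ × ℝ := fun z =>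
    (z.1.1.1, z.2.1.1, z.1.2, z.2.2, z.1.1.2, z.2.1.2)
  have hG : Function.Injective G := by
    rintro ⟨⟨⟨a, b⟩, d⟩, ⟨⟨e, f⟩, h⟩⟩ ⟨⟨⟨a', b'⟩, d'⟩, ⟨⟨e', f'⟩, h'⟩⟩ hh
    simp only [G, Prod.mk.injEq] at hh ⊢
    tauto
  have hPS : P.card ≤ S.ncard := by
    rw [← Finset.card_image_of_injective P hG, ← Set.ncard_coe_finset]
    apply Set.ncard_le_ncard _ hfin
    intro y hy
    obtain ⟨z, hz, rfl⟩ := Finset.mem_image.1 (Finset.mem_coe.1 hy)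
    rw [hP] at hz
    obtain ⟨⟨m, a⟩, ⟨m', a'⟩⟩ := z
    simp only [Finset.mem_filter, Finset.mem_product, F, Prod.mk.injEq] at hz
    obtain ⟨⟨⟨hm, ha⟩, hm', ha'⟩, h1, h2⟩ := hz
    obtain ⟨k1, k2, k3, k4⟩ := key_inj M (cls A t) (cls (A + A) t) g (cls_mono A t ht0)
      (cls_mono _ t ht0) hgm m m' hm hm' a a' h1 h2
    have q1 := Finset.mem_product.1 (hM hm)
    have q2 := Finset.mem_product.1 (hM hm')
    rw [hS]
    exact ⟨m.1, m'.1, a, a', m.2, m'.2, rfl, q1.1, q2.1, ha, ha', q1.2, q2.2, hm, hm',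
      close_of_cls A t _ _ ht0 hA k1, close_of_cls A t _ _ ht0 hA k3,
      close_of_cls _ t _ _ ht0 hAA k4, hgc _ _ k2⟩
  have hcard : ((Finset.Icc (c - k) (c + 2 * k) ×ˢ Finset.Icc c (c + 3 * k)).card : ℝ)
      = (3 * (k : ℝ) + 1) ^ 2 := by
    rw [Finset.card_product, Int.card_Icc, Int.card_Icc]
    have e1 : (((c + 2 * k + 1 - (c - k)).toNat : ℕ) : ℤ) = 3 * k + 1 := by omega
    have e2 : (((c + 3 * k + 1 - c).toNat : ℕ) : ℤ) = 3 * k + 1 := by omega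
    have e1' : (((c + 2 * k + 1 - (c - k)).toNat : ℕ) : ℝ) = 3 * k + 1 := by exact_mod_cast e1
    have e2' : (((c + 3 * k + 1 - c).toNat : ℕ) : ℝ) = 3 * k + 1 := by exact_mod_cast e2
    rw [Nat.cast_mul, e1', e2', sq]
  have hcs' : ((M.card : ℝ) * A.card) ^ 2 ≤ (3 * (k : ℝ) + 1) ^ 2 * S.ncard := by
    rw [← hcard]
    have : ((M ×ˢ A).card ^ 2 : ℕ) ≤
        (Finset.Icc (c - k) (c + 2 * k) ×ˢ Finset.Icc c (c + 3 * k)).card * S.ncard :=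
      hcs.trans (Nat.mul_le_mul_left _ hPS)
    rw [Finset.card_product M A] at this
    exact_mod_cast this
  have hk1' : (1 : ℝ) ≤ k := by exact_mod_cast hk1
  have hb : (t * (3 * (k : ℝ) + 1)) ^ 2 ≤ 4 ^ 2 := by
    apply pow_le_pow_left₀ (by positivity)
    nlinarith
  have hSn : (0 : ℝ) ≤ S.ncard := by positivity
  have f1 := mul_le_mul_of_nonneg_left hcs' (sq_nonneg t)
  have f2 := mul_le_mul_of_nonneg_right hb hSn
  nlinarith
end

section
/- Let g, p, h ∈ ℝ[x] with deg g ≥ 2 and deg h ≥ 1, let f(x,y) = g(x + p(y)) + h(y), let A, B ⊆ ℝ be finite sets, and let t ∈ (0,1] satisfy t|A| ≥ 1 and t|B| ≥ 1. Define Q = {(a_1, a_2, b_1, b_2) ∈ A² × B² : f(a_1, b_1) = f(a_2, b_2)} and R̃_t = {(a_1, a_2, a_1′, a_2′, b_1, b_2) ∈ A² × A² × B² : f(a_1, b_1) = f(a_2, b_2), the pairs (a_1, a_2) and (a_1′, a_2′) are t-close in A, (a_1 + a_1′, a_2 + a_2′) is t-close in A + A, and (b_1, b_2) is t-close in B}.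 Then there exists a constant c > 0, depending only on deg f, such that |R̃_t| ≥ c · t²|A|²|Q|. -/
open Polynomial Finset Pointwise

/-- `f(x, y) = g(x + p(y)) + h(y)`. -/
noncomputable def fval (g p h : Polynomial ℝ) (x y : ℝ) : ℝ :=
  g.eval (x + p.eval y) + h.eval y

/-- The energy set `Q = {(a₁, a₂, b₁, b₂) ∈ A² × B² : f(a₁, b₁) = f(a₂, b₂)}`. -/
def Qset (g p h : Polynomial ℝ) (A B : Finset ℝ) : Set (ℝ × ℝ × ℝ × ℝ) :=
  {q | ∃ a₁ a₂ b₁ b₂ : ℝ, q = (a₁, a₂, b₁, b₂) ∧ a₁ ∈ A ∧ a₂ ∈ A ∧ b₁ ∈ B ∧ b₂ ∈ B ∧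
    fval g p h a₁ b₁ = fval g p h a₂ b₂}

/-- The proximity-restricted set `R̃_t`. -/
def Rtildeset (g p h : Polynomial ℝ) (A B : Finset ℝ) (t : ℝ) :
    Set (ℝ × ℝ × ℝ × ℝ × ℝ × ℝ) :=
  {r | ∃ a₁ a₂ a₁' a₂' b₁ b₂ : ℝ, r = (a₁, a₂, a₁', a₂', b₁, b₂) ∧
    a₁ ∈ A ∧ a₂ ∈ A ∧ a₁' ∈ A ∧ a₂' ∈ A ∧ b₁ ∈ B ∧ b₂ ∈ B ∧
    fval g p h a₁ b₁ = fval g p h a₂ b₂ ∧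
    tClose A t a₁ a₂ ∧ tClose A t a₁' a₂' ∧
    tClose (A + A) t (a₁ + a₁') (a₂ + a₂') ∧ tClose B t b₁ b₂}


lemma cs_pairs_s15 {α β : Type*} [DecidableEq α] [DecidableEq β] (S : Finset α) (κ : α → β) :
    S.card ^ 2 ≤ (S.image κ).card * ((S ×ˢ S).filter (fun q => κ q.1 = κ q.2)).card := by
  have h1 : S.card = ∑ b ∈ S.image κ, (S.filter (fun a => κ a = b)).card :=
    Finset.card_eq_sum_card_image κ S
  have h2 : ((S ×ˢ S).filter (fun q => κ q.1 = κ q.2)).card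
      = ∑ b ∈ S.image κ, (S.filter (fun a => κ a = b)).card ^ 2 := by
    rw [Finset.card_eq_sum_card_fiberwise (f := fun q => κ q.1) (t := S.image κ)]
    · refine Finset.sum_congr rfl fun b _ => ?_
      rw [sq, ← Finset.card_product]
      congr 1
      ext ⟨x, y⟩
      simp only [Finset.mem_filter, Finset.mem_product]
      constructor
      · rintro ⟨⟨⟨hx, hy⟩, h⟩, h'⟩
        exact ⟨⟨hx, h'⟩, hy, by rw [← h, h']⟩
      · rintro ⟨⟨hx, h'⟩, hy, h⟩
        exact ⟨⟨⟨hx, hy⟩, by rw [h', h]⟩, h'⟩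
    · intro q hq
      simp only [Finset.coe_filter, Finset.mem_product, Set.mem_ofPred_eq] at hq
      exact Finset.mem_coe.2 (Finset.mem_image_of_mem _ hq.1.1)
  rw [h2]
  calc S.card ^ 2 = (∑ b ∈ S.image κ, (S.filter (fun a => κ a = b)).card) ^ 2 := by rw [← h1]
    _ ≤ _ := sq_sum_le_card_mul_sum_sq

/-- The cell of `x`. -/
noncomputable def cellf (X : Finset ℝ) (t x : ℝ) : ℕ :=
  ⌊(idx X x : ℝ) / (t * (X.card : ℝ))⌋₊

lemma cellf_mono (X : Finset ℝ) (t : ℝ) (ht : 0 < t) : Monotone (cellf X t) := by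
  intro x y hxy
  unfold cellf
  apply Nat.floor_mono
  have : idx X x ≤ idx X y := by
    unfold idx
    apply Finset.card_le_card
    intro z hz
    simp only [Finset.mem_filter] at hz ⊢
    exact ⟨hz.1, hz.2.trans hxy⟩
  have : (idx X x : ℝ) ≤ idx X y := by exact_mod_cast this
  gcongr

lemma cellf_lt (X : Finset ℝ) (t x : ℝ) (ht : 0 < t) (hX : 0 < X.card) :
    cellf X t x < ⌊1 / t⌋₊ + 1 := by
  apply Nat.lt_succ_of_le
  unfold cellf
  apply Nat.floor_mono
  have h1 : (idx X x : ℝ) ≤ X.card := by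
    exact_mod_cast Finset.card_filter_le _ _
  have h2 : (0 : ℝ) < X.card := by exact_mod_cast hX
  rw [div_le_div_iff₀ (by positivity) ht]
  nlinarith

lemma cellf_close (X : Finset ℝ) (t x y : ℝ) (ht : 0 < t) (hX : 0 < X.card)
    (h : cellf X t x = cellf X t y) : tClose X t x y := by
  have h2 : (0 : ℝ) < t * X.card := by
    have : (0 : ℝ) < X.card := by exact_mod_cast hX
    positivity
  unfold tClose
  unfold cellf at h
  have a1 := Nat.floor_le (a := (idx X x : ℝ) / (t * (X.card : ℝ))) (by positivity)
  have a2 := Nat.lt_floor_add_one ((idx X x : ℝ) / (t * (X.card : ℝ)))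
  have b1 := Nat.floor_le (a := (idx X y : ℝ) / (t * (X.card : ℝ))) (by positivity)
  have b2 := Nat.lt_floor_add_one ((idx X y : ℝ) / (t * (X.card : ℝ)))
  rw [h] at a1 a2
  rw [le_div_iff₀ h2] at a1 b1
  rw [div_lt_iff₀ h2] at a2 b2
  rw [abs_le]
  constructor <;> nlinarith

/-- membership of `l` in the interval `I_{m,k}`. -/
def inI (iS : ℝ → ℕ) (lo hi : ℕ → ℝ) (u : ℝ) (k l : ℕ) : Prop :=
  iS (u + lo k) ≤ l ∧ l ≤ iS (u + hi k)

open Classical in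
lemma kl_count (K : ℕ) (iS : ℝ → ℕ) (hS : Monotone iS)
    (lo hi : ℕ → ℝ) (Ks : Finset ℕ) (hKs : ∀ k ∈ Ks, k < K)
    (hsep : ∀ k ∈ Ks, ∀ k' ∈ Ks, k < k' → hi k ≤ lo k') (u : ℝ) :
    ((Ks ×ˢ range K).filter (fun q => inI iS lo hi u q.1 q.2)).card ≤ 2 * K := by
  rw [← Finset.card_range (2 * K)]
  apply Finset.card_le_card_of_injOn (fun q => q.1 + q.2)
  · rintro ⟨k, l⟩ h
    simp only [coe_filter, mem_product, mem_range, Set.mem_ofPred_eq, coe_range, Set.mem_Iio] at h ⊢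
    have := hKs k h.1.1
    omega
  · have key : ∀ k ∈ Ks, ∀ k' ∈ Ks, ∀ l l', k < k' → inI iS lo hi u k l → inI iS lo hi u k' l' →
        l ≤ l' := by
      intro k hk k' hk' l l' hlt h h'
      have := hsep k hk k' hk' hlt
      have : iS (u + hi k) ≤ iS (u + lo k') := hS (by linarith)
      exact h.2.trans (this.trans h'.1)
    rintro ⟨k, l⟩ h ⟨k', l'⟩ h' e
    simp only [coe_filter, mem_product, mem_range, Set.mem_ofPred_eq] at h h' e
    have q1 := key k h.1.1 k' h'.1.1 l l'
    have q2 := key k' h'.1.1 k h.1.1 l' l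
    rcases lt_trichotomy k k' with c | c | c
    · have := q1 c h.2 h'.2; omega
    · subst c; simp; omega
    · have := q2 c h'.2 h.2; omega

open Classical in
lemma change_count (n K D : ℕ) (x y : ℕ → ℝ) (iA iB : ℝ → ℕ)
    (hA : Monotone iA) (hB : Monotone iB) (hA' : ∀ u, iA u < K) (hB' : ∀ u, iB u < K)
    (hy : ∀ i j, i ≤ j → j < n → y i ≤ y j)
    (hcross : ∀ U : ℝ → Prop, (∀ u u', u ≤ u' → U u → U u') →
      ((range n).filter (fun m => m ≠ 0 ∧ ¬ (U (x (m-1)) ↔ U (x m)))).card ≤ D) :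
    ((range n).filter (fun m => m = 0 ∨ ¬ (iA (x (m-1)) = iA (x m) ∧ iB (y (m-1)) = iB (y m)))).card
      ≤ 1 + K * D + K := by
  have hsub : ((range n).filter (fun m => m = 0 ∨
      ¬ (iA (x (m-1)) = iA (x m) ∧ iB (y (m-1)) = iB (y m)))) ⊆
      ({0} ∪ (range K).biUnion (fun q => (range n).filter
        (fun m => m ≠ 0 ∧ ¬ (q ≤ iA (x (m-1)) ↔ q ≤ iA (x m))))) ∪
      (range n).filter (fun m => m ≠ 0 ∧ iB (y (m-1)) ≠ iB (y m)) := by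
    intro m hm
    simp only [mem_filter, mem_range, mem_union, mem_singleton, mem_biUnion] at hm ⊢
    by_cases h0 : m = 0
    · simp [h0]
    by_cases h1 : iA (x (m-1)) = iA (x m)
    · right
      refine ⟨hm.1, h0, fun h2 => ?_⟩
      rcases hm.2 with h | h
      · exact h0 h
      · exact h ⟨h1, h2⟩
    · left; right
      rcases lt_or_gt_of_ne h1 with h | h
      · exact ⟨iA (x m), hA' _, hm.1, h0, fun hh => by have := hh.2 le_rfl; omega⟩
      · exact ⟨iA (x (m-1)), hA' _, hm.1, h0, fun hh => by have := hh.1 le_rfl; omega⟩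
  refine (Finset.card_le_card hsub).trans ?_
  refine (Finset.card_union_le _ _).trans ?_
  apply Nat.add_le_add
  · refine (Finset.card_union_le _ _).trans ?_
    apply Nat.add_le_add (by simp)
    have := Finset.card_biUnion_le_card_mul (range K) (fun q => (range n).filter
        (fun m => m ≠ 0 ∧ ¬ (q ≤ iA (x (m-1)) ↔ q ≤ iA (x m)))) D
      (fun q _ => by
        convert hcross (fun u => q ≤ iA u) (fun u u' huu h => h.trans (hA huu)))
    simpa using this
  · rw [← Finset.card_range K]
    apply Finset.card_le_card_of_injOn (fun m => iB (y m))
    · intro m _; simpa using hB' _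
    · have key : ∀ m m', m < m' → m' < n → iB (y (m'-1)) ≠ iB (y m') → iB (y m) < iB (y m') := by
        intro m m' h hn hne
        have h1 := hB (hy m (m'-1) (by omega) (by omega))
        have h2 := hB (hy (m'-1) m' (by omega) (by omega))
        omega
      intro m hm m' hm' e
      simp only [coe_filter, mem_range, Set.mem_ofPred_eq] at hm hm' e
      rcases lt_trichotomy m m' with c | c | c
      · have := key m m' c hm'.1 hm'.2.2; omega
      · exact c
      · have := key m' m c hm.1 hm.2.2; omega

open Classical in
lemma cell_count (n K D : ℕ) (hK : 1 ≤ K) (x y : ℕ → ℝ) (iA iB iS : ℝ → ℕ) (A : Finset ℝ)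
    (hA : Monotone iA) (hB : Monotone iB) (hS : Monotone iS)
    (hA' : ∀ u, iA u < K) (hB' : ∀ u, iB u < K) (hS' : ∀ u, iS u < K)
    (hy : ∀ i j, i ≤ j → j < n → y i ≤ y j)
    (hcross : ∀ U : ℝ → Prop, (∀ u u', u ≤ u' → U u → U u') →
      ((range n).filter (fun m => m ≠ 0 ∧ ¬ (U (x (m-1)) ↔ U (x m)))).card ≤ D) :
    ((range n ×ˢ A).image (fun q => (iA (x q.1), iB (y q.1), iA q.2, iS (x q.1 + q.2)))).card
      ≤ (4 + 4 * D) * K ^ 2 := by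
  -- extreme elements
  have hex : ∀ k, ∃ q : ℝ × ℝ, k ∈ A.image iA → (q.1 ∈ A ∧ iA q.1 = k ∧ q.2 ∈ A ∧ iA q.2 = k ∧
      ∀ a ∈ A, iA a = k → q.1 ≤ a ∧ a ≤ q.2) := by
    intro k
    by_cases hk : k ∈ A.image iA
    · have hne : (A.filter (fun a => iA a = k)).Nonempty := by
        obtain ⟨a, ha, hk⟩ := Finset.mem_image.1 hk
        exact ⟨a, by simp [ha, hk]⟩
      have m1 := Finset.min'_mem _ hne
      have m2 := Finset.max'_mem _ hne
      simp only [mem_filter] at m1 m2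
      refine ⟨(_, _), fun _ => ⟨m1.1, m1.2, m2.1, m2.2, fun a ha hak => ⟨?_, ?_⟩⟩⟩
      · exact Finset.min'_le _ _ (by simp [ha, hak])
      · exact Finset.le_max' _ _ (by simp [ha, hak])
    · exact ⟨(0, 0), fun h => absurd h hk⟩
  choose e he using hex
  set lo : ℕ → ℝ := fun k => (e k).1 with hlo
  set hi : ℕ → ℝ := fun k => (e k).2 with hhi
  set Ks := A.image iA with hKsdef
  have hKs : ∀ k ∈ Ks, k < K := by
    intro k hk
    obtain ⟨a, _, rfl⟩ := Finset.mem_image.1 hk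
    exact hA' a
  have hKsc : Ks.card ≤ K := by
    have : Ks ⊆ range K := fun k hk => Finset.mem_range.2 (hKs k hk)
    simpa using Finset.card_le_card this
  have hsep : ∀ k ∈ Ks, ∀ k' ∈ Ks, k < k' → hi k ≤ lo k' := by
    intro k hk k' hk' h
    by_contra hc
    have h1 := hA (le_of_lt (not_le.1 hc))
    have e1 := (he k hk).2.2.2.1
    have e2 := (he k' hk').2.1
    simp only [hlo, hhi] at h1
    omega
  set Ch := (range n).filter (fun m => m = 0 ∨
    ¬ (iA (x (m-1)) = iA (x m) ∧ iB (y (m-1)) = iB (y m))) with hCh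
  have hChc : Ch.card ≤ 1 + K * D + K := change_count n K D x y iA iB hA hB hA' hB' hy hcross
  set T1 := Ch.biUnion (fun m => ((Ks ×ˢ range K).filter
    (fun q => inI iS lo hi (x m) q.1 q.2)).image (fun q => (m, q))) with hT1
  set T2 := (Ks ×ˢ range K).biUnion (fun q => (((range n).filter (fun m => m ≠ 0 ∧
      ¬ (q.2 + 1 ≤ iS (x (m-1) + lo q.1) ↔ q.2 + 1 ≤ iS (x m + lo q.1)))) ∪
      ((range n).filter (fun m => m ≠ 0 ∧
      ¬ (q.2 ≤ iS (x (m-1) + hi q.1) ↔ q.2 ≤ iS (x m + hi q.1))))).image (fun m => (m, q))) with hT2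
  have hT1c : T1.card ≤ (1 + K * D + K) * (2 * K) := by
    refine (Finset.card_biUnion_le_card_mul _ _ (2 * K) ?_).trans (Nat.mul_le_mul_right _ hChc)
    intro m _
    exact Finset.card_image_le.trans (kl_count K iS hS lo hi Ks hKs hsep _)
  have hT2c : T2.card ≤ (K * K) * (D + D) := by
    refine (Finset.card_biUnion_le_card_mul _ _ (D + D) ?_).trans (Nat.mul_le_mul_right _ ?_)
    · intro q _
      refine Finset.card_image_le.trans ((Finset.card_union_le _ _).trans ?_)
      apply Nat.add_le_add
      · convert hcross (fun u => q.2 + 1 ≤ iS (u + lo q.1))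
          (fun u u' huu h => h.trans (hS (by linarith)))
      · convert hcross (fun u => q.2 ≤ iS (u + hi q.1))
          (fun u u' huu h => h.trans (hS (by linarith)))
    · rw [Finset.card_product, Finset.card_range]
      exact Nat.mul_le_mul_right _ hKsc
  have hsub : ((range n ×ˢ A).image
      (fun q => (iA (x q.1), iB (y q.1), iA q.2, iS (x q.1 + q.2)))) ⊆
      (T1 ∪ T2).image (fun q => (iA (x q.1), iB (y q.1), q.2.1, q.2.2)) := by
    intro c hc
    obtain ⟨⟨m, a⟩, hma, rfl⟩ := Finset.mem_image.1 hc
    simp only [mem_product, mem_range] at hma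
    have hk : iA a ∈ Ks := Finset.mem_image_of_mem _ hma.2
    have hin : inI iS lo hi (x m) (iA a) (iS (x m + a)) := by
      have := (he _ hk).2.2.2.2 a hma.2 rfl
      exact ⟨hS (by simp only [hlo]; linarith), hS (by simp only [hhi]; linarith)⟩
    have hP : ∃ m', m' < n ∧ iA (x m') = iA (x m) ∧ iB (y m') = iB (y m) ∧
        inI iS lo hi (x m') (iA a) (iS (x m + a)) := ⟨m, hma.1, rfl, rfl, hin⟩
    set m0 := Nat.find hP with hm0
    obtain ⟨g1, g2, g3, g4⟩ := Nat.find_spec hP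
    have hmin := fun {m'} (h : m' < m0) => Nat.find_min hP h
    rw [← hm0] at g1 g2 g3 g4
    refine Finset.mem_image.2 ⟨(m0, iA a, iS (x m + a)), ?_, by simp [g2, g3]⟩
    have hkl : (iA a, iS (x m + a)) ∈ Ks ×ˢ range K := by
      simp only [mem_product, mem_range]; exact ⟨hk, hS' _⟩
    rw [Finset.mem_union]
    by_cases hc : m0 ∈ Ch
    · left
      refine Finset.mem_biUnion.2 ⟨m0, hc, Finset.mem_image.2 ⟨_, Finset.mem_filter.2 ⟨hkl, g4⟩, rfl⟩⟩
    · right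
      refine Finset.mem_biUnion.2 ⟨_, hkl, Finset.mem_image.2 ⟨m0, ?_, rfl⟩⟩
      have hc2 := fun h => hc (Finset.mem_filter.2 ⟨Finset.mem_range.2 g1, h⟩)
      rw [imp_false, not_or, not_not] at hc2
      obtain ⟨c0, c1, c2⟩ := hc2
      have hm := hmin (m' := m0 - 1) (by omega)
      have hnot : ¬ inI iS lo hi (x (m0-1)) (iA a) (iS (x m + a)) :=
        fun h => hm ⟨by omega, c1.trans g2, c2.trans g3, h⟩
      simp only [mem_union, mem_filter, mem_range]
      unfold inI at hnot g4
      by_cases h1 : iS (x (m0-1) + lo (iA a)) ≤ iS (x m + a)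
      · right
        refine ⟨g1, c0, fun h => hnot ⟨h1, h.2 g4.2⟩⟩
      · left
        refine ⟨g1, c0, fun h => ?_⟩
        have := h.1 (by omega)
        omega
  have := (Finset.card_le_card hsub).trans (Finset.card_image_le.trans (Finset.card_union_le _ _))
  nlinarith [mul_le_mul hK hK]

/-- Along a strictly increasing sequence, each point lies in at most two of the consecutive
closed intervals. -/
lemma interval_count (n : ℕ) (y : ℕ → ℝ) (hy : ∀ i j, i < j → j < n → y i < y j)
    (M : Finset ℕ) (Z : Finset ℝ)
    (hM : ∀ m ∈ M, m < n ∧ m ≠ 0 ∧ ∃ w ∈ Z, y (m-1) ≤ w ∧ w ≤ y m) :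
    M.card ≤ 2 * Z.card := by
  classical
  have hw : ∀ m, ∃ w, m ∈ M → (w ∈ Z ∧ y (m-1) ≤ w ∧ w ≤ y m) := by
    intro m
    by_cases h : m ∈ M
    · obtain ⟨_, _, w, h1, h2⟩ := hM m h
      exact ⟨w, fun _ => ⟨h1, h2⟩⟩
    · exact ⟨0, fun h' => absurd h' h⟩
  choose w hw using hw
  have hc : (Z ×ˢ (Finset.univ : Finset Bool)).card = 2 * Z.card := by
    rw [Finset.card_product]; simp [mul_comm]
  rw [← hc]
  apply Finset.card_le_card_of_injOn (fun m => (w m, decide (w m = y (m-1))))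
  · intro m hm
    simp only [Finset.coe_product, Set.mem_prod, Finset.mem_coe, Finset.mem_univ, and_true]
    exact (hw m hm).1
  · have key : ∀ m ∈ M, ∀ m' ∈ M, m < m' → w m = w m' → w m' = y (m'-1) ∧ w m ≠ y (m-1) := by
      intro m hm m' hm' hlt he
      have h1 := hw m hm
      have h2 := hw m' hm'
      have hm0 := hM m hm
      have hm0' := hM m' hm'
      have h3 : y m ≤ y (m'-1) := by
        rcases Nat.lt_or_ge m (m'-1) with c | c
        · exact (hy _ _ c (by omega)).le
        · have : m = m' - 1 := by omega
          rw [this]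
      have h4 : y (m-1) < y m := hy _ _ (by omega) hm0.1
      constructor
      · linarith [h1.2.2, h2.2.1]
      · intro hh; linarith [h1.2.2, h2.2.1]
    intro m hm m' hm' he
    simp only [Prod.mk.injEq, decide_eq_decide] at he
    rcases lt_trichotomy m m' with c | c | c
    · have := key m hm m' hm' c he.1; tauto
    · exact c
    · have := key m' hm' m hm c he.1.symm; tauto

/-- Clamped intermediate value argument. -/
lemma ivt_clamp (g p h : Polynomial ℝ) (v s L R : ℝ) (hLR : L ≤ R)
    (hg : MonotoneOn (fun z => g.eval z) (Set.Icc L R) ∨ AntitoneOn (fun z => g.eval z) (Set.Icc L R))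
    (x1 y1 x2 y2 : ℝ) (hz1 : x1 + p.eval y1 ∈ Set.Icc L R) (hz2 : x2 + p.eval y2 ∈ Set.Icc L R)
    (h1 : fval g p h x1 y1 = v) (h2 : fval g p h x2 y2 = v) (hy : y1 ≤ y2)
    (hs : (x1 ≤ s ∧ s ≤ x2) ∨ (x2 ≤ s ∧ s ≤ x1)) :
    ∃ w, y1 ≤ w ∧ w ≤ y2 ∧ (fval g p h s w = v ∨ h.eval w = v - g.eval L ∨
      h.eval w = v - g.eval R) := by
  set G : ℝ → ℝ := fun y => g.eval (max L (min R (s + p.eval y))) + h.eval y - v with hG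
  have hcont : Continuous G := by
    have c1 : Continuous fun y => max L (min R (s + p.eval y)) := by
      have := p.continuous
      fun_prop
    have c2 := g.continuous.comp c1
    have c3 := h.continuous
    exact (c2.add c3).sub continuous_const
  have hcl : ∀ y, max L (min R (s + p.eval y)) ∈ Set.Icc L R := fun y =>
    ⟨le_max_left _ _, max_le hLR (min_le_left _ _)⟩
  unfold fval at h1 h2
  have hge : ∀ x y, x + p.eval y ∈ Set.Icc L R → x ≤ s →
      x + p.eval y ≤ max L (min R (s + p.eval y)) := by
    intro x y hx hxs
    exact le_max_of_le_right (le_min hx.2 (by linarith))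
  have hle : ∀ x y, x + p.eval y ∈ Set.Icc L R → s ≤ x →
      max L (min R (s + p.eval y)) ≤ x + p.eval y := by
    intro x y hx hxs
    exact max_le hx.1 (min_le_of_right_le (by linarith))
  have h0 : (0 : ℝ) ∈ Set.uIcc (G y1) (G y2) := by
    rw [Set.mem_uIcc]
    simp only [hG]
    rcases hg with hg | hg <;> rcases hs with ⟨a, b⟩ | ⟨a, b⟩
    · right
      have e1 := hg hz1 (hcl y1) (hge _ _ hz1 a)
      have e2 := hg (hcl y2) hz2 (hle _ _ hz2 b)
      simp only at e1 e2
      constructor <;> linarith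
    · left
      have e1 := hg hz2 (hcl y2) (hge _ _ hz2 a)
      have e2 := hg (hcl y1) hz1 (hle _ _ hz1 b)
      simp only at e1 e2
      constructor <;> linarith
    · left
      have e1 := hg hz1 (hcl y1) (hge _ _ hz1 a)
      have e2 := hg (hcl y2) hz2 (hle _ _ hz2 b)
      simp only at e1 e2
      constructor <;> linarith
    · right
      have e1 := hg hz2 (hcl y2) (hge _ _ hz2 a)
      have e2 := hg (hcl y1) hz1 (hle _ _ hz1 b)
      simp only at e1 e2
      constructor <;> linarith
  obtain ⟨w, hw, hw0⟩ := intermediate_value_uIcc hcont.continuousOn h0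
  rw [Set.uIcc_of_le hy] at hw
  refine ⟨w, hw.1, hw.2, ?_⟩
  simp only [hG] at hw0
  unfold fval
  rcases max_choice L (min R (s + p.eval w)) with c | c
  · right; left; rw [c] at hw0; linarith
  · rw [c] at hw0
    rcases min_choice R (s + p.eval w) with c | c
    · right; right; rw [c] at hw0; linarith
    · left; rw [c] at hw0; linarith

lemma generic_s (g p h : Polynomial ℝ) (v : ℝ) (hg : 2 ≤ g.natDegree) (a b : ℝ) (hab : a < b) :
    ∃ s, a < s ∧ s < b ∧ g.comp (C s + p) + h - C v ≠ 0 := by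
  set q : Polynomial ℝ := g.comp (X + C (p.eval 0)) + C (h.eval 0 - v) with hq
  have hq0 : q ≠ 0 := by
    intro h0
    have : q.natDegree = g.natDegree := by
      rw [hq, natDegree_add_C, natDegree_comp, natDegree_X_add_C, mul_one]
    rw [h0, natDegree_zero] at this
    omega
  obtain ⟨s, hs, hs'⟩ := (Set.Ioo_infinite hab).exists_notMem_finset q.roots.toFinset
  refine ⟨s, hs.1, hs.2, fun h0 => hs' ?_⟩
  rw [Multiset.mem_toFinset, mem_roots hq0, IsRoot.def, hq]
  have := congrArg (fun r => eval 0 r) h0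
  simp only [eval_add, eval_sub, eval_comp, eval_C, eval_zero, eval_X] at this ⊢
  linarith

lemma zeros_card (q : Polynomial ℝ) (N : ℕ) (hN : q.natDegree ≤ N) : q.roots.toFinset.card ≤ N :=
  (Multiset.toFinset_card_le _).trans (q.card_roots'.trans hN)

open Classical in
lemma cross_count (d : ℕ) (g p h : Polynomial ℝ) (v L R : ℝ) (hgd : g.natDegree ≤ d)
    (hpd : p.natDegree ≤ d) (hhd : h.natDegree ≤ d) (hg2 : 2 ≤ g.natDegree)
    (hh1 : 1 ≤ h.natDegree)
    (hg : MonotoneOn (fun z => g.eval z) (Set.Icc L R) ∨ AntitoneOn (fun z => g.eval z) (Set.Icc L R))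
    (n : ℕ) (x y : ℕ → ℝ) (hy : ∀ i j, i < j → j < n → y i < y j)
    (hz : ∀ m < n, x m + p.eval (y m) ∈ Set.Icc L R)
    (hv : ∀ m < n, fval g p h (x m) (y m) = v)
    (U : ℝ → Prop) (hU : ∀ u u', u ≤ u' → U u → U u') :
    ((range n).filter (fun m => m ≠ 0 ∧ ¬ (U (x (m-1)) ↔ U (x m)))).card
      ≤ 2 * (d * d + 3 * d) := by
  by_cases hn : n = 0
  · subst hn; simp
  have hLR : L ≤ R := (hz 0 (by omega)).1.trans (hz 0 (by omega)).2
  have hs : ∃ s, (∀ m < n, U (x m) → s ≤ x m) ∧ (∀ m < n, ¬ U (x m) → x m ≤ s) ∧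
      g.comp (C s + p) + h - C v ≠ 0 := by
    -- thresholds
    set P := ((range n).filter (fun m => U (x m))).image x with hP
    set N := ((range n).filter (fun m => ¬ U (x m))).image x with hN
    have hPm : ∀ m < n, U (x m) → x m ∈ P := fun m hm hu =>
      Finset.mem_image_of_mem _ (by simp [hm, hu])
    have hNm : ∀ m < n, ¬ U (x m) → x m ∈ N := fun m hm hu =>
      Finset.mem_image_of_mem _ (by simp [hm, hu])
    have hab : ∃ a b : ℝ, a < b ∧ (∀ m < n, U (x m) → b ≤ x m) ∧ (∀ m < n, ¬ U (x m) → x m ≤ a) := by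
      by_cases hPe : P.Nonempty
      · by_cases hNe : N.Nonempty
        · refine ⟨N.max' hNe, P.min' hPe, ?_, fun m hm hu => P.min'_le _ (hPm m hm hu),
            fun m hm hu => N.le_max' _ (hNm m hm hu)⟩
          obtain ⟨m1, q1, e1⟩ := Finset.mem_image.1 (N.max'_mem hNe)
          obtain ⟨m2, q2, e2⟩ := Finset.mem_image.1 (P.min'_mem hPe)
          rw [← e1, ← e2]
          by_contra hc
          exact (Finset.mem_filter.1 q1).2 (hU _ _ (not_lt.1 hc) (Finset.mem_filter.1 q2).2)
        · refine ⟨P.min' hPe - 1, P.min' hPe, by linarith, fun m hm hu => P.min'_le _ (hPm m hm hu),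
            fun m hm hu => absurd ⟨_, hNm m hm hu⟩ hNe⟩
      · by_cases hNe : N.Nonempty
        · exact ⟨N.max' hNe, N.max' hNe + 1, by linarith,
            fun m hm hu => absurd ⟨_, hPm m hm hu⟩ hPe,
            fun m hm hu => N.le_max' _ (hNm m hm hu)⟩
        · exact ⟨0, 1, by norm_num, fun m hm hu => absurd ⟨_, hPm m hm hu⟩ hPe,
            fun m hm hu => absurd ⟨_, hNm m hm hu⟩ hNe⟩
    obtain ⟨a, b, hab, hb, ha⟩ := hab
    obtain ⟨s, h1, h2, h3⟩ := generic_s g p h v hg2 a b hab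
    exact ⟨s, fun m hm hu => h2.le.trans (hb m hm hu), fun m hm hu => (ha m hm hu).trans h1.le, h3⟩
  obtain ⟨s, hs1, hs2, hs3⟩ := hs
  set q0 := g.comp (C s + p) + h - C v with hq0
  have hne : ∀ c : ℝ, h - C c ≠ 0 := by
    intro c h0
    have : (h - C c).natDegree = h.natDegree := natDegree_sub_C
    rw [h0, natDegree_zero] at this
    omega
  set Z := (q0.roots.toFinset ∪ (h - C (v - g.eval L)).roots.toFinset) ∪
    (h - C (v - g.eval R)).roots.toFinset with hZ
  have hZc : Z.card ≤ d * d + 3 * d := by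
    have a1 : q0.roots.toFinset.card ≤ d * d + d := by
      apply zeros_card
      rw [hq0, natDegree_sub_C]
      refine (natDegree_add_le _ _).trans (max_le ?_ (by omega))
      rw [natDegree_comp, add_comm (C s), natDegree_add_C]
      exact (Nat.mul_le_mul hgd hpd).trans (by omega)
    have a2 : ∀ c, (h - C c).roots.toFinset.card ≤ d := fun c =>
      zeros_card _ _ (by rw [natDegree_sub_C]; exact hhd)
    rw [hZ]
    refine (Finset.card_union_le _ _).trans ?_
    refine (Nat.add_le_add ((Finset.card_union_le _ _).trans (Nat.add_le_add a1 (a2 _))) (a2 _)).trans ?_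
    linarith
  refine (interval_count n y hy _ Z ?_).trans (Nat.mul_le_mul_left _ hZc)
  intro m hm
  simp only [mem_filter, mem_range] at hm
  obtain ⟨hmn, hm0, hmU⟩ := hm
  refine ⟨hmn, hm0, ?_⟩
  have hor : (x (m-1) ≤ s ∧ s ≤ x m) ∨ (x m ≤ s ∧ s ≤ x (m-1)) := by
    by_cases c1 : U (x (m-1))
    · have c2 : ¬ U (x m) := fun c2 => hmU ⟨fun _ => c2, fun _ => c1⟩
      exact Or.inr ⟨hs2 m hmn c2, hs1 (m-1) (by omega) c1⟩
    · have c2 : U (x m) := by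
        by_contra c2
        exact hmU ⟨fun h => absurd h c1, fun h => absurd h c2⟩
      exact Or.inl ⟨hs2 (m-1) (by omega) c1, hs1 m hmn c2⟩
  obtain ⟨w, w1, w2, w3⟩ := ivt_clamp g p h v s L R hLR hg (x (m-1)) (y (m-1)) (x m) (y m)
    (hz _ (by omega)) (hz _ hmn) (hv _ (by omega)) (hv _ hmn) (hy _ _ (by omega) hmn).le hor
  refine ⟨w, ?_, w1, w2⟩
  simp only [hZ, Finset.mem_union, Multiset.mem_toFinset, mem_roots hs3, mem_roots (hne _), IsRoot.def]
  simp only [hq0, eval_sub, eval_add, eval_comp, eval_C]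
  unfold fval at w3
  rcases w3 with w3 | w3 | w3
  · left; left; linarith
  · left; right; linarith
  · right; linarith

/-- The monotonicity class of `z` for `g`. -/
noncomputable def mcls (g : Polynomial ℝ) (z : ℝ) : ℕ :=
  ((derivative g).roots.toFinset.filter (fun r => r ≤ z)).card

lemma mcls_lt (d : ℕ) (g : Polynomial ℝ) (hg : g.natDegree ≤ d) (z : ℝ) : mcls g z < d + 1 := by
  unfold mcls
  have h1 := Finset.card_filter_le (derivative g).roots.toFinset (fun r => r ≤ z)
  have h2 := zeros_card (derivative g) d ((natDegree_derivative_le g).trans (by omega))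
  omega

lemma mono_of_mcls (g : Polynomial ℝ) (hg : 2 ≤ g.natDegree) (L R : ℝ) (hLR : L ≤ R)
    (h : mcls g L = mcls g R) :
    StrictMonoOn (fun z => g.eval z) (Set.Icc L R) ∨
      StrictAntiOn (fun z => g.eval z) (Set.Icc L R) := by
  apply ContinuousOn.strictMonoOn_of_injOn_Icc' hLR g.continuous.continuousOn
  have hd : derivative g ≠ 0 := by
    intro h0
    have := Polynomial.derivative_eq_zero.1 h0
    omega
  have key : ∀ u ∈ Set.Icc L R, ∀ w ∈ Set.Icc L R, u < w → g.eval u ≠ g.eval w := by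
    intro u hu w hw huw he
    obtain ⟨c, hc, hc0⟩ := exists_deriv_eq_zero (f := fun z => g.eval z) huw
      g.continuous.continuousOn he
    rw [Polynomial.deriv] at hc0
    have : mcls g L < mcls g R := by
      unfold mcls
      apply Finset.card_lt_card
      rw [Finset.ssubset_iff_of_subset]
      · refine ⟨c, ?_, ?_⟩
        · simp only [Finset.mem_filter, Multiset.mem_toFinset, mem_roots hd, IsRoot.def]
          exact ⟨hc0, hc.2.le.trans hw.2⟩
        · simp only [Finset.mem_filter, not_and, not_le]
          intro _
          exact hu.1.trans_lt hc.1
      · intro r hr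
        simp only [Finset.mem_filter] at hr ⊢
        exact ⟨hr.1, hr.2.trans hLR⟩
    omega
  intro u hu w hw he
  rcases lt_trichotomy u w with c | c | c
  · exact absurd he (key u hu w hw c)
  · exact c
  · exact absurd he.symm (key w hw u hu c)

open Classical in
lemma class_count (d : ℕ) (g p h : Polynomial ℝ) (v : ℝ) (hgd : g.natDegree ≤ d)
    (hpd : p.natDegree ≤ d) (hhd : h.natDegree ≤ d) (hg2 : 2 ≤ g.natDegree)
    (hh1 : 1 ≤ h.natDegree) (K : ℕ) (hK : 1 ≤ K) (iA iB iS : ℝ → ℕ) (A : Finset ℝ)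
    (hA : Monotone iA) (hB : Monotone iB) (hS : Monotone iS)
    (hA' : ∀ u, iA u < K) (hB' : ∀ u, iB u < K) (hS' : ∀ u, iS u < K)
    (P : Finset (ℝ × ℝ)) (e : ℕ) (hP : ∀ q ∈ P, fval g p h q.1 q.2 = v)
    (hPe : ∀ q ∈ P, mcls g (q.1 + p.eval q.2) = e) :
    ((P ×ˢ A).image (fun q => (iA q.1.1, iB q.1.2, iA q.2, iS (q.1.1 + q.2)))).card
      ≤ (4 + 4 * (2 * (d * d + 3 * d))) * K ^ 2 := by
  by_cases hne : P.Nonempty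
  swap
  · rw [Finset.not_nonempty_iff_eq_empty] at hne
    subst hne; simp
  set Zs := P.image (fun q => q.1 + p.eval q.2) with hZs
  have hZne : Zs.Nonempty := hne.image _
  set L := Zs.min' hZne with hL
  set R := Zs.max' hZne with hR
  have hz : ∀ q ∈ P, q.1 + p.eval q.2 ∈ Set.Icc L R := fun q hq =>
    ⟨Zs.min'_le _ (Finset.mem_image_of_mem _ hq), Zs.le_max' _ (Finset.mem_image_of_mem _ hq)⟩
  have hLR : L ≤ R := Zs.min'_le _ (Zs.max'_mem hZne)
  have hLc : mcls g L = e := by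
    obtain ⟨q, hq, hqe⟩ := Finset.mem_image.1 (Zs.min'_mem hZne)
    rw [hL, ← hqe]; exact hPe q hq
  have hRc : mcls g R = e := by
    obtain ⟨q, hq, hqe⟩ := Finset.mem_image.1 (Zs.max'_mem hZne)
    rw [hR, ← hqe]; exact hPe q hq
  have hmono := mono_of_mcls g hg2 L R hLR (hLc.trans hRc.symm)
  have hinj : Set.InjOn (fun z => g.eval z) (Set.Icc L R) := by
    rcases hmono with hm | hm
    · exact hm.injOn
    · exact hm.injOn
  have hfst : ∀ a a' b, (a, b) ∈ P → (a', b) ∈ P → a = a' := by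
    intro a a' b h1 h2
    have e1 := hP _ h1
    have e2 := hP _ h2
    unfold fval at e1 e2
    have := hinj (hz _ h1) (hz _ h2) (by simp only; simp only at e1 e2; linarith)
    simp only at this
    linarith
  set Y := P.image Prod.snd with hY
  set n := Y.card with hn
  set y : ℕ → ℝ := fun m => if hm : m < n then Y.orderEmbOfFin rfl ⟨m, hm⟩ else 0 with hydef
  have hy1 : ∀ m (hm : m < n), y m = Y.orderEmbOfFin rfl ⟨m, hm⟩ := fun m hm => by
    simp only [hydef, dif_pos hm]
  have hylt : ∀ i j, i < j → j < n → y i < y j := by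
    intro i j hij hj
    rw [hy1 i (by omega), hy1 j hj]
    exact (Y.orderEmbOfFin rfl).strictMono hij
  have hyle : ∀ i j, i ≤ j → j < n → y i ≤ y j := by
    intro i j hij hj
    rcases hij.lt_or_eq with c | c
    · exact (hylt i j c hj).le
    · rw [c]
  have hyY : ∀ m < n, y m ∈ Y := fun m hm => by
    rw [hy1 m hm]; exact Y.orderEmbOfFin_mem rfl _
  have hysurj : ∀ b ∈ Y, ∃ m < n, y m = b := by
    intro b hb
    have : b ∈ Set.range (Y.orderEmbOfFin rfl) := by
      rw [Finset.range_orderEmbOfFin]; exact hb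
    obtain ⟨⟨m, hm⟩, hmb⟩ := this
    exact ⟨m, hm, by rw [hy1 m hm, hmb]⟩
  have hx : ∀ m, ∃ x, m < n → (x, y m) ∈ P := by
    intro m
    by_cases hm : m < n
    · obtain ⟨⟨a, b⟩, hq, hqe⟩ := Finset.mem_image.1 (hyY m hm)
      refine ⟨a, fun _ => ?_⟩
      rw [← hqe]; exact hq
    · exact ⟨0, fun h => absurd h hm⟩
  choose x hx using hx
  have hcc := cell_count n K (2 * (d * d + 3 * d)) hK x y iA iB iS A hA hB hS hA' hB' hS' hyle
    (fun U hU => by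
      have := cross_count d g p h v L R hgd hpd hhd hg2 hh1
        (hmono.imp StrictMonoOn.monotoneOn StrictAntiOn.antitoneOn) n x y hylt
        (fun m hm => hz _ (hx m hm)) (fun m hm => hP _ (hx m hm)) U hU
      convert this)
  refine (Finset.card_le_card ?_).trans hcc
  intro c hc
  obtain ⟨⟨⟨a, b⟩, a'⟩, hq, rfl⟩ := Finset.mem_image.1 hc
  simp only [Finset.mem_product] at hq
  obtain ⟨m, hm, hmb⟩ := hysurj b (Finset.mem_image_of_mem Prod.snd hq.1)
  refine Finset.mem_image.2 ⟨(m, a'), by simp [hm, hq.2], ?_⟩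
  have h1 := hx m hm
  rw [hmb] at h1
  have h2 := hfst _ _ _ h1 hq.1
  simp only [hmb, h2]

open Classical in
lemma level_count (d : ℕ) (g p h : Polynomial ℝ) (v : ℝ) (hgd : g.natDegree ≤ d)
    (hpd : p.natDegree ≤ d) (hhd : h.natDegree ≤ d) (hg2 : 2 ≤ g.natDegree)
    (hh1 : 1 ≤ h.natDegree) (K : ℕ) (hK : 1 ≤ K) (iA iB iS : ℝ → ℕ) (A : Finset ℝ)
    (hA : Monotone iA) (hB : Monotone iB) (hS : Monotone iS)
    (hA' : ∀ u, iA u < K) (hB' : ∀ u, iB u < K) (hS' : ∀ u, iS u < K)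
    (P : Finset (ℝ × ℝ)) (hP : ∀ q ∈ P, fval g p h q.1 q.2 = v) :
    ((P ×ˢ A).image (fun q => (iA q.1.1, iB q.1.2, iA q.2, iS (q.1.1 + q.2)))).card
      ≤ (d + 1) * ((4 + 4 * (2 * (d * d + 3 * d))) * K ^ 2) := by
  set κ : (ℝ × ℝ) × ℝ → ℕ × ℕ × ℕ × ℕ :=
    fun q => (iA q.1.1, iB q.1.2, iA q.2, iS (q.1.1 + q.2)) with hκ
  set Pe : ℕ → Finset (ℝ × ℝ) := fun e => P.filter (fun q => mcls g (q.1 + p.eval q.2) = e) with hPe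
  have hsub : (P ×ˢ A).image κ ⊆ (range (d + 1)).biUnion (fun e => (Pe e ×ˢ A).image κ) := by
    intro c hc
    obtain ⟨q, hq, rfl⟩ := Finset.mem_image.1 hc
    rw [Finset.mem_product] at hq
    refine Finset.mem_biUnion.2 ⟨mcls g (q.1.1 + p.eval q.1.2),
      Finset.mem_range.2 (mcls_lt d g hgd _), Finset.mem_image_of_mem _ ?_⟩
    rw [Finset.mem_product]
    exact ⟨Finset.mem_filter.2 ⟨hq.1, rfl⟩, hq.2⟩
  refine (Finset.card_le_card hsub).trans ?_
  have := Finset.card_biUnion_le_card_mul (range (d + 1)) (fun e => (Pe e ×ˢ A).image κ)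
    ((4 + 4 * (2 * (d * d + 3 * d))) * K ^ 2) (fun e _ =>
      class_count d g p h v hgd hpd hhd hg2 hh1 K hK iA iB iS A hA hB hS hA' hB' hS' (Pe e) e
        (fun q hq => hP q (Finset.mem_filter.1 hq).1) (fun q hq => (Finset.mem_filter.1 hq).2))
  simpa using this

theorem stmt15 (d : ℕ) :
    ∃ c : ℝ, 0 < c ∧
      ∀ g p h : Polynomial ℝ,
        g.natDegree ≤ d → p.natDegree ≤ d → h.natDegree ≤ d →
        2 ≤ g.natDegree → 1 ≤ h.natDegree →
        ∀ (A B : Finset ℝ) (t : ℝ), 0 < t → t ≤ 1 →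
          1 ≤ t * (A.card : ℝ) → 1 ≤ t * (B.card : ℝ) →
          c * t ^ 2 * (A.card : ℝ) ^ 2 * ((Qset g p h A B).ncard : ℝ)
            ≤ ((Rtildeset g p h A B t).ncard : ℝ) := by
  classical
  set E : ℕ := (d + 1) * (4 + 4 * (2 * (d * d + 3 * d))) with hE
  have hE0 : 0 < E := by positivity
  have hE0' : (0 : ℝ) < E := by exact_mod_cast hE0
  refine ⟨1 / (4 * E), by positivity, ?_⟩
  intro g p h hgd hpd hhd hg2 hh1 A B t ht ht1 hA hB
  have hAc : 0 < A.card := by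
    rcases Nat.eq_zero_or_pos A.card with h0 | h0
    · rw [h0] at hA; norm_num at hA
    · exact h0
  have hBc : 0 < B.card := by
    rcases Nat.eq_zero_or_pos B.card with h0 | h0
    · rw [h0] at hB; norm_num at hB
    · exact h0
  have hSc : 0 < (A + A).card := by
    have hne := Finset.card_pos.1 hAc
    exact Finset.card_pos.2 (hne.add hne)
  set K : ℕ := ⌊1 / t⌋₊ + 1 with hK
  have hKt : (K : ℝ) * t ≤ 2 := by
    have h1 := Nat.floor_le (a := 1 / t) (by positivity)
    have h2 : (⌊1 / t⌋₊ : ℝ) * t ≤ 1 := by rwa [le_div_iff₀ ht] at h1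
    rw [hK]; push_cast; nlinarith
  set V := (A ×ˢ B).image (fun q => fval g p h q.1 q.2) with hV
  set P : ℝ → Finset (ℝ × ℝ) := fun v => (A ×ˢ B).filter (fun q => fval g p h q.1 q.2 = v) with hP
  set κ : (ℝ × ℝ) × ℝ → ℕ × ℕ × ℕ × ℕ :=
    fun q => (cellf A t q.1.1, cellf B t q.1.2, cellf A t q.2, cellf (A + A) t (q.1.1 + q.2)) with hκ
  set W : ℝ → Finset (((ℝ × ℝ) × ℝ) × ((ℝ × ℝ) × ℝ)) := fun v =>
    ((P v ×ˢ A) ×ˢ (P v ×ˢ A)).filter (fun q => κ q.1 = κ q.2) with hW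
  -- per level bound
  have hlev : ∀ v, ((P v).card * A.card) ^ 2 ≤ E * K ^ 2 * (W v).card := by
    intro v
    have h1 := cs_pairs_s15 (P v ×ˢ A) κ
    have h2 := level_count d g p h v hgd hpd hhd hg2 hh1 K (by omega) (cellf A t) (cellf B t)
      (cellf (A + A) t) A (cellf_mono A t ht) (cellf_mono B t ht) (cellf_mono _ t ht)
      (fun u => cellf_lt A t u ht hAc) (fun u => cellf_lt B t u ht hBc)
      (fun u => cellf_lt _ t u ht hSc) (P v) (fun q hq => (Finset.mem_filter.1 hq).2)
    rw [Finset.card_product] at h1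
    refine h1.trans (Nat.mul_le_mul_right _ ?_)
    rw [hE, mul_assoc]
    convert h2
  -- the set Q
  have hQ : (Qset g p h A B).ncard ≤ ∑ v ∈ V, (P v).card ^ 2 := by
    have hsub : Qset g p h A B ⊆ ((V.biUnion (fun v => (P v ×ˢ P v).image
        (fun q => (q.1.1, q.2.1, q.1.2, q.2.2))) : Finset (ℝ × ℝ × ℝ × ℝ)) : Set (ℝ × ℝ × ℝ × ℝ)) := by
      rintro q ⟨a₁, a₂, b₁, b₂, rfl, ha₁, ha₂, hb₁, hb₂, hf⟩
      refine Finset.mem_coe.2 (Finset.mem_biUnion.2 ⟨fval g p h a₁ b₁,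
        Finset.mem_image.2 ⟨(a₁, b₁), Finset.mem_product.2 ⟨ha₁, hb₁⟩, rfl⟩,
        Finset.mem_image.2 ⟨((a₁, b₁), (a₂, b₂)), ?_, rfl⟩⟩)
      simp [hP, ha₁, ha₂, hb₁, hb₂, hf]
    refine (Set.ncard_le_ncard hsub (Finset.finite_toSet _)).trans ?_
    rw [Set.ncard_coe_finset]
    refine Finset.card_biUnion_le.trans (Finset.sum_le_sum fun v _ => ?_)
    refine Finset.card_image_le.trans ?_
    rw [Finset.card_product, sq]
  -- the set R
  have hR : ∑ v ∈ V, (W v).card ≤ (Rtildeset g p h A B t).ncard := by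
    rw [← Finset.card_biUnion]
    · rw [← Set.ncard_coe_finset]
      refine Set.ncard_le_ncard_of_injOn
        (fun q => (q.1.1.1, q.2.1.1, q.1.2, q.2.2, q.1.1.2, q.2.1.2)) ?_ ?_ ?_
      · rintro ⟨⟨⟨a₁, b₁⟩, a₁'⟩, ⟨⟨a₂, b₂⟩, a₂'⟩⟩ hq
        obtain ⟨v, _, hq⟩ := Finset.mem_biUnion.1 (Finset.mem_coe.1 hq)
        simp only [hW, hP, hκ, Finset.mem_filter, Finset.mem_product, Prod.mk.injEq] at hq
        obtain ⟨⟨⟨⟨⟨q1, q2⟩, q3⟩, q4⟩, ⟨⟨q5, q6⟩, q7⟩, q8⟩, k1, k2, k3, k4⟩ := hq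
        exact ⟨a₁, a₂, a₁', a₂', b₁, b₂, rfl, q1, q5, q4, q8, q2, q6, q3.trans q7.symm,
          cellf_close A t _ _ ht hAc k1, cellf_close A t _ _ ht hAc k3,
          cellf_close _ t _ _ ht hSc k4, cellf_close B t _ _ ht hBc k2⟩
      · rintro ⟨⟨⟨a₁, b₁⟩, a₁'⟩, ⟨⟨a₂, b₂⟩, a₂'⟩⟩ _ ⟨⟨⟨c₁, d₁⟩, c₁'⟩, ⟨⟨c₂, d₂⟩, c₂'⟩⟩ _ he
        simp only [Prod.mk.injEq] at he ⊢
        tauto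
      · refine Set.Finite.subset (Finset.finite_toSet
          (A ×ˢ A ×ˢ A ×ˢ A ×ˢ B ×ˢ B)) ?_
        rintro q ⟨a₁, a₂, a₁', a₂', b₁, b₂, rfl, h1, h2, h3, h4, h5, h6, _⟩
        simp [h1, h2, h3, h4, h5, h6]
    · intro v _ v' _ hne
      refine Finset.disjoint_left.2 ?_
      intro q hq hq'
      simp only [hW, hP, Finset.mem_filter, Finset.mem_product] at hq hq'
      exact hne (hq.1.1.1.2.symm.trans hq'.1.1.1.2)
  have hmain : (Qset g p h A B).ncard * A.card ^ 2 ≤ E * K ^ 2 * (Rtildeset g p h A B t).ncard := by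
    calc (Qset g p h A B).ncard * A.card ^ 2 ≤ (∑ v ∈ V, (P v).card ^ 2) * A.card ^ 2 :=
          Nat.mul_le_mul_right _ hQ
      _ = ∑ v ∈ V, ((P v).card * A.card) ^ 2 := by
          rw [Finset.sum_mul]; exact Finset.sum_congr rfl fun v _ => by ring
      _ ≤ ∑ v ∈ V, E * K ^ 2 * (W v).card := Finset.sum_le_sum fun v _ => hlev v
      _ = E * K ^ 2 * ∑ v ∈ V, (W v).card := by rw [Finset.mul_sum]
      _ ≤ _ := Nat.mul_le_mul_left _ hR
  have hmain' : ((Qset g p h A B).ncard : ℝ) * (A.card : ℝ) ^ 2 ≤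
      E * (K : ℝ) ^ 2 * ((Rtildeset g p h A B t).ncard : ℝ) := by exact_mod_cast hmain
  set r : ℝ := ((Rtildeset g p h A B t).ncard : ℝ) with hr
  have hr0 : 0 ≤ r := by positivity
  have hK2 : ((K : ℝ) * t) ^ 2 ≤ 4 := by
    have : 0 ≤ (K : ℝ) * t := by positivity
    nlinarith
  calc 1 / (4 * (E : ℝ)) * t ^ 2 * (A.card : ℝ) ^ 2 * ((Qset g p h A B).ncard : ℝ)
      = 1 / (4 * (E : ℝ)) * t ^ 2 * (((Qset g p h A B).ncard : ℝ) * (A.card : ℝ) ^ 2) := by ring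
    _ ≤ 1 / (4 * (E : ℝ)) * t ^ 2 * (E * (K : ℝ) ^ 2 * r) := by gcongr
    _ = (((K : ℝ) * t) ^ 2 / 4) * r := by field_simp
    _ ≤ 1 * r := by
        apply mul_le_mul_of_nonneg_right _ hr0
        linarith
    _ = r := one_mul r
end
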